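/- Let n ≥ 0 and let A be an (n+1)×(n+1) matrix of integers with det A ≠ 0. For 0 ≤ j ≤ n define ρ_j^{A} ∈ (ℂˣ)^{n+1} by (ρ_j^{A})_i := exp(2π√(-1)·(A⁻¹)_{ij}) and ρ_j^{Aᵀ} ∈ (ℂˣ)^{n+1} by (ρ_j^{Aᵀ})_i := exp(2π√(-1)·(A⁻¹)_{ji}), and set j_A := ρ_0^{A}·ρ_1^{A}⋯ρ_n^{A}. Let G be a subgroup of G_A := {λ ∈ (ℂˣ)^{n+1} : ∀ i, ∏_j λ_j^{A_{ij}} = 1}, and let G^T := {∏_{j=0}^n (ρ_j^{Aᵀ})^{s_j} : s ∈ ℤ^{n+1} such that ∏_{j=0}^n g_j^{s_j} = 1 for all g ∈ G}. If j_A ∈ G, then G^T ⊆ SL_{Aᵀ} := {μ ∈ G_{Aᵀ} : ∏_{i=0}^n μ_i = 1}, where G_{Aᵀ} := {μ ∈ (ℂˣ)^{n+1} : ∀ i, ∏_j μ_j^{A_{ji}} = 1}. -/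

import Mathlib

open Finset Matrix

/-- `ρ_j^B ∈ (ℂˣ)^{n+1}` obtained by exponentiating the `j`-th column of a rational
matrix `B` via `t ↦ exp(2π√(-1)·t)`. -/
noncomputable def expCol (n : ℕ) (B : Matrix (Fin (n + 1)) (Fin (n + 1)) ℚ)
    (j : Fin (n + 1)) : Fin (n + 1) → ℂˣ :=
  fun i => Units.mk0 (Complex.exp (2 * Real.pi * Complex.I * ((B i j : ℚ) : ℂ)))
    (Complex.exp_ne_zero _)

/-- If `B * M = 1` with `M` integral, then the exponentiated columns of `Bᵀ` are diagonal
symmetries for `Mᵀ`. -/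
theorem prod_expCol_transpose_zpow_eq_one (n : ℕ)
    (B : Matrix (Fin (n + 1)) (Fin (n + 1)) ℚ) (M : Matrix (Fin (n + 1)) (Fin (n + 1)) ℤ)
    (hBM : B * M.map ((↑) : ℤ → ℚ) = 1) (k i : Fin (n + 1)) :
    ∏ j, (expCol n Bᵀ k j) ^ M j i = 1 := by
  have hsum : ∑ j, ((B k j : ℚ) : ℂ) * (M j i : ℂ) = if k = i then 1 else 0 := by
    have h := congrFun (congrFun hBM k) i
    simp only [Matrix.mul_apply, Matrix.map_apply, Matrix.one_apply] at h
    simpa [apply_ite ((↑) : ℚ → ℂ)] using congrArg ((↑) : ℚ → ℂ) h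
  ext
  simp only [expCol, Matrix.transpose_apply, Units.coe_prod, Units.val_zpow_eq_zpow_val,
    Units.val_mk0, Units.val_one, ← Complex.exp_int_mul, ← Complex.exp_sum]
  have hfactor : ∑ j, (M j i : ℂ) * (2 * Real.pi * Complex.I * ((B k j : ℚ) : ℂ)) =
      2 * Real.pi * Complex.I * ∑ j, ((B k j : ℚ) : ℂ) * (M j i : ℂ) := by
    rw [Finset.mul_sum]
    exact Finset.sum_congr rfl fun j _ => by ring
  rw [hfactor, hsum]
  split_ifs <;> simp [Complex.exp_two_pi_mul_I]

/-- If `G ≤ G_A` contains the exponential grading operator `j_A = ρ_0^A ⋯ ρ_n^A`, then the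
Krawitz dual group `G^T` is contained in `SL(F_{Aᵀ})`, the determinant-one diagonal
symmetries of the transposed polynomial. -/
theorem dual_group_subset_SL_of_grading_mem
    (n : ℕ) (A : Matrix (Fin (n + 1)) (Fin (n + 1)) ℤ) (hA : A.det ≠ 0)
    (G : Subgroup (Fin (n + 1) → ℂˣ))
    (hG : (G : Set (Fin (n + 1) → ℂˣ)) ⊆
      {lam : Fin (n + 1) → ℂˣ | ∀ i, ∏ j, (lam j) ^ A i j = 1})
    (hjA : (∏ j, expCol n ((A.map ((↑) : ℤ → ℚ))⁻¹) j) ∈ G) :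
    {mu : Fin (n + 1) → ℂˣ | ∃ s : Fin (n + 1) → ℤ,
        (∀ g ∈ G, ∏ j, (g j) ^ s j = 1) ∧
        mu = ∏ j, (expCol n (((A.map ((↑) : ℤ → ℚ))⁻¹)ᵀ) j) ^ s j} ⊆
      {mu : Fin (n + 1) → ℂˣ |
        (∀ i, ∏ j, (mu j) ^ A j i = 1) ∧ ∏ i, mu i = 1} := by
  rintro mu ⟨s, hs, rfl⟩
  have hBA : (A.map ((↑) : ℤ → ℚ))⁻¹ * A.map ((↑) : ℤ → ℚ) = 1 := by
    refine Matrix.nonsing_inv_mul _ (isUnit_iff_ne_zero.mpr ?_)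
    have hdet := (Int.castRingHom ℚ).map_det A
    rw [RingHom.mapMatrix_apply] at hdet
    exact hdet ▸ Int.cast_ne_zero.mpr hA
  refine ⟨fun i => ?_, ?_⟩
  · simp only [Finset.prod_apply, Pi.pow_apply, ← Finset.prod_zpow]
    rw [Finset.prod_comm]
    refine Finset.prod_eq_one fun k _ => ?_
    simp only [zpow_comm _ (s k)]
    rw [Finset.prod_zpow, prod_expCol_transpose_zpow_eq_one n _ A hBA k i, _root_.one_zpow]
  · have h := hs _ hjA
    simp only [Finset.prod_apply, ← Finset.prod_zpow] at h
    simp only [Finset.prod_apply, Pi.pow_apply]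
    rw [Finset.prod_comm]
    exact h
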